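/- arXiv:2510.17103 — 9 statements merged into one kernel-verified Lean document; each statement's English description precedes it below -/
import Mathlib

section
/- Fix a layered episodic MDP with transition function P, let π and π' be two policies, and let ℓ : S × A → ℝ be any loss function. Define ℓ̄ : S × A → ℝ by ℓ̄(s,a) = Q^{P,π}(s,a; ℓ) − V^{P,π}(s; ℓ) for all s ∈ S and a ∈ A. Then for every state s ∈ S and every action a ∈ A: V^{P,π'}(s; ℓ̄) = V^{P,π'}(s; ℓ) − V^{P,π}(s; ℓ), and Q^{P,π'}(s,a; ℓ̄) = Q^{P,π'}(s,a; ℓ) − V^{P,π}(s; ℓ). -/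
open MeasureTheory Finset

/-- A layered episodic MDP: finite state set `S` partitioned into layers `0, …, L` by `layer`,
with unique initial state `s0` (layer `0`), unique terminal state `sL` (layer `L`),
nonempty layers, and a transition function `P` supported on consecutive layers with rows
summing to `1` on non-terminal layers. -/
structure LayeredMDP (S A : Type) [Fintype S] [Fintype A] where
  L : ℕ
  layer : S → ℕ
  s0 : S
  sL : S
  P : S → A → S → ℝ
  layer_le : ∀ s, layer s ≤ L
  layer_s0 : layer s0 = 0
  layer_sL : layer sL = L
  s0_unique : ∀ s, layer s = 0 → s = s0
  sL_unique : ∀ s, layer s = L → s = sL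
  layer_nonempty : ∀ k, k ≤ L → ∃ s, layer s = k
  P_nonneg : ∀ s a s', 0 ≤ P s a s'
  P_layer : ∀ s a s', P s a s' ≠ 0 → layer s' = layer s + 1
  P_sum : ∀ s a, layer s < L → ∑ s', P s a s' = 1

variable {S A : Type} [Fintype S] [Fintype A] [DecidableEq S] [DecidableEq A]

/-- `pol` is a policy: nonnegative, and rows sum to `1` at every non-terminal state. -/
def IsPolicy (M : LayeredMDP S A) (pol : S → A → ℝ) : Prop :=
  (∀ s a, 0 ≤ pol s a) ∧ ∀ s, s ≠ M.sL → ∑ a, pol s a = 1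

/-- State-action value function computed with `n` remaining layers of fuel. -/
noncomputable def Qfuel (M : LayeredMDP S A) (pol l : S → A → ℝ) :
    ℕ → S → A → ℝ
  | 0, _, _ => 0
  | n + 1, s, a => l s a + ∑ s', M.P s a s' * ∑ a', pol s' a' * Qfuel M pol l n s' a'

/-- The state-action value function `Q^{P,π}(s,a; ℓ)`. -/
noncomputable def Qval (M : LayeredMDP S A) (pol l : S → A → ℝ) (s : S) (a : A) : ℝ :=
  if M.layer s = M.L then 0 else Qfuel M pol l (M.L - M.layer s) s a

/-- The state value function `V^{P,π}(s; ℓ) = ∑_a π(a|s) Q^{P,π}(s,a; ℓ)`. -/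
noncomputable def Vval (M : LayeredMDP S A) (pol l : S → A → ℝ) (s : S) : ℝ :=
  ∑ a, pol s a * Qval M pol l s a

/-- A trajectory `(s_0, a_0, …, s_{L-1}, a_{L-1}, s_L)`. -/
abbrev Traj (M : LayeredMDP S A) : Type := (Fin (M.L + 1) → S) × (Fin M.L → A)

/-- Probability of a given trajectory under policy `pol`. -/
noncomputable def trajProb (M : LayeredMDP S A) (pol : S → A → ℝ) (τ : Traj M) : ℝ :=
  (if τ.1 0 = M.s0 then (1 : ℝ) else 0) *
    ∏ k : Fin M.L, pol (τ.1 k.castSucc) (τ.2 k) * M.P (τ.1 k.castSucc) (τ.2 k) (τ.1 k.succ)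

/-- Indicator `𝕀(s)` that the trajectory visits state `s` at its layer. -/
noncomputable def stInd (M : LayeredMDP S A) (τ : Traj M) (s : S) : ℝ :=
  if τ.1 ⟨M.layer s, Nat.lt_succ_of_le (M.layer_le s)⟩ = s then 1 else 0

/-- Indicator `𝕀(s,a)` that the trajectory visits `(s,a)` at the layer of `s`. -/
noncomputable def saInd (M : LayeredMDP S A) (τ : Traj M) (s : S) (a : A) : ℝ :=
  if h : M.layer s < M.L then
    if τ.1 ⟨M.layer s, Nat.lt_succ_of_le (M.layer_le s)⟩ = s ∧ τ.2 ⟨M.layer s, h⟩ = a then 1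
    else 0
  else 0

/-- Occupancy measure `q^{P,π}(s,a) = Pr[(s_k, a_k) = (s,a)]`. -/
noncomputable def occSA (M : LayeredMDP S A) (pol : S → A → ℝ) (s : S) (a : A) : ℝ :=
  ∑ τ : Traj M, trajProb M pol τ * saInd M τ s a

/-- Occupancy measure `q^{P,π}(s) = Pr[s_k = s]`. -/
noncomputable def occS (M : LayeredMDP S A) (pol : S → A → ℝ) (s : S) : ℝ :=
  ∑ τ : Traj M, trajProb M pol τ * stInd M τ s

/-- Aggregate loss `∑_{k=0}^{L-1} ℓ(s_k, a_k)` of a trajectory. -/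
noncomputable def aggLoss (M : LayeredMDP S A) (l : S → A → ℝ) (τ : Traj M) : ℝ :=
  ∑ k : Fin M.L, l (τ.1 k.castSucc) (τ.2 k)

/-- At the terminal layer the state-action value function vanishes. -/
theorem Qval_of_layer_eq (M : LayeredMDP S A) (pol l : S → A → ℝ) {s : S}
    (hs : M.layer s = M.L) (a : A) : Qval M pol l s a = 0 :=
  if_pos hs

/-- At the terminal layer the state value function vanishes. -/
theorem Vval_of_layer_eq (M : LayeredMDP S A) (pol l : S → A → ℝ) {s : S}
    (hs : M.layer s = M.L) : Vval M pol l s = 0 := by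
  simp [Vval, Qval_of_layer_eq M pol l hs]

/-- The Bellman equation at non-terminal states. -/
theorem Qval_eq_add_sum (M : LayeredMDP S A) (pol l : S → A → ℝ) {s : S}
    (hs : M.layer s < M.L) (a : A) :
    Qval M pol l s a = l s a + ∑ s', M.P s a s' * Vval M pol l s' := by
  obtain ⟨n, hn⟩ : ∃ n, M.L - M.layer s = n + 1 := ⟨M.L - M.layer s - 1, by omega⟩
  rw [Qval, if_neg hs.ne, hn, Qfuel]
  congr 1
  refine Finset.sum_congr rfl fun s' _ => ?_
  by_cases hP : M.P s a s' = 0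
  · simp [hP]
  have hlayer := M.P_layer s a s' hP
  rw [Vval]
  congr 1
  refine Finset.sum_congr rfl fun a' _ => ?_
  congr 1
  rw [Qval]
  split_ifs with h
  · obtain rfl : n = 0 := by omega
    rfl
  · rw [show M.L - M.layer s' = n by omega]

/-- If the state-action value functions differ by a function of the state, then at a non-terminal
state the state value functions differ by the same amount. -/
theorem Vval_eq_sub_of_Qval_eq_sub (M : LayeredMDP S A) {pol : S → A → ℝ}
    (hpol : IsPolicy M pol) (l l' : S → A → ℝ) {s : S} (hs : M.layer s < M.L) {c : ℝ}
    (h : ∀ a, Qval M pol l' s a = Qval M pol l s a - c) :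
    Vval M pol l' s = Vval M pol l s - c := by
  have hne : s ≠ M.sL := by
    rintro rfl
    exact hs.ne M.layer_sL
  simp only [Vval, h, mul_sub, Finset.sum_sub_distrib, ← Finset.sum_mul, hpol.2 s hne, one_mul]

/-- Lemma 1, performance-difference identity.
If `ℓ̄(s,a) = Q^{P,π}(s,a;ℓ) − V^{P,π}(s;ℓ)`, then for every policy `π'`, every `s` and `a`,
`V^{P,π'}(s;ℓ̄) = V^{P,π'}(s;ℓ) − V^{P,π}(s;ℓ)` and
`Q^{P,π'}(s,a;ℓ̄) = Q^{P,π'}(s,a;ℓ) − V^{P,π}(s;ℓ)`. -/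
theorem stmt0 (M : LayeredMDP S A) (pol pol' : S → A → ℝ)
    (hpol : IsPolicy M pol) (hpol' : IsPolicy M pol')
    (l : S → A → ℝ) (lbar : S → A → ℝ)
    (hlbar : ∀ s a, lbar s a = Qval M pol l s a - Vval M pol l s) :
    ∀ (s : S) (a : A),
      Vval M pol' lbar s = Vval M pol' l s - Vval M pol l s ∧
      Qval M pol' lbar s a = Qval M pol' l s a - Vval M pol l s := by
  intro s
  induction hd : M.L - M.layer s generalizing s with
  | zero =>
    have hs : M.layer s = M.L := le_antisymm (M.layer_le s) (by omega)
    intro a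
    simp [Vval_of_layer_eq, Qval_of_layer_eq, hs]
  | succ n ih =>
    have hs : M.layer s < M.L := by omega
    have hQ : ∀ a, Qval M pol' lbar s a = Qval M pol' l s a - Vval M pol l s := by
      intro a
      have hsum : ∑ s', M.P s a s' * Vval M pol' lbar s' =
          ∑ s', M.P s a s' * Vval M pol' l s' - ∑ s', M.P s a s' * Vval M pol l s' := by
        rw [← Finset.sum_sub_distrib]
        refine Finset.sum_congr rfl fun s' _ => ?_
        by_cases hP : M.P s a s' = 0
        · simp [hP]
        have hlayer := M.P_layer s a s' hP
        rw [(ih s' (by omega) a).1, mul_sub]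
      rw [Qval_eq_add_sum M pol' lbar hs, Qval_eq_add_sum M pol' l hs, hlbar,
        Qval_eq_add_sum M pol l hs, hsum]
      ring
    exact fun a => ⟨Vval_eq_sub_of_Qval_eq_sub M hpol' l lbar hs hQ, hQ a⟩
end

section
/- Fix a layered episodic MDP with transition function P and a policy π, generate a random trajectory under π, and let c be a real random variable defined on the same probability space such that the conditional expectation of c given the trajectory equals Σ_{k=0}^{L−1} ℓ(s_k, a_k), where ℓ : S × A → ℝ is a loss function. Fix s ∈ S ∖ {s_L} and a ∈ A with q(s,a) > 0, and define the loss estimator ℓ̂(s,a) = c·( 𝕀(s,a)/q(s,a) − 𝕀(s)/q(s) ). Then E[ ℓ̂(s,a) ] = Q^{P,π}(s,a; ℓ) − V^{P,π}(s; ℓ). -/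
open MeasureTheory Finset

variable {S A : Type} [Fintype S] [Fintype A] [DecidableEq S] [DecidableEq A]

/-- The weighted sum of `f` over length-`n` paths starting at `x`, each path being weighted by its
probability under the policy `pol`. -/
noncomputable def pathSum (M : LayeredMDP S A) (pol : S → A → ℝ) (n : ℕ) (x : S)
    (f : (Fin (n + 1) → S) × (Fin n → A) → ℝ) : ℝ :=
  ∑ τ : (Fin (n + 1) → S) × (Fin n → A), (if τ.1 0 = x then (1 : ℝ) else 0) *
    (∏ k : Fin n, pol (τ.1 k.castSucc) (τ.2 k) * M.P (τ.1 k.castSucc) (τ.2 k) (τ.1 k.succ)) * f τ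

/-- The total loss along a path of length `n`. -/
def pathLoss (l : S → A → ℝ) {n : ℕ} (τ : (Fin (n + 1) → S) × (Fin n → A)) : ℝ :=
  ∑ k : Fin n, l (τ.1 k.castSucc) (τ.2 k)

lemma pathLoss_cons (l : S → A → ℝ) {n : ℕ} (x : S) (b : A)
    (τ : (Fin (n + 1) → S) × (Fin n → A)) :
    pathLoss l (n := n + 1) (Fin.cons x τ.1, Fin.cons b τ.2) = l x b + pathLoss l τ := by
  simp [pathLoss, Fin.sum_univ_succ]

lemma pathSum_add (M : LayeredMDP S A) (pol : S → A → ℝ) (n : ℕ) (x : S)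
    (f g : (Fin (n + 1) → S) × (Fin n → A) → ℝ) :
    pathSum M pol n x (fun τ => f τ + g τ) = pathSum M pol n x f + pathSum M pol n x g := by
  simp only [pathSum, mul_add, sum_add_distrib]

lemma pathSum_const_mul (M : LayeredMDP S A) (pol : S → A → ℝ) (n : ℕ) (x : S) (r : ℝ)
    (f : (Fin (n + 1) → S) × (Fin n → A) → ℝ) :
    pathSum M pol n x (fun τ => r * f τ) = r * pathSum M pol n x f := by
  simp only [pathSum, mul_sum]
  exact sum_congr rfl fun _ _ => by ring

lemma pathSum_zero (M : LayeredMDP S A) (pol : S → A → ℝ) (x : S)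
    (f : (Fin 1 → S) × (Fin 0 → A) → ℝ) :
    pathSum M pol 0 x f = f (fun _ => x, Fin.elim0) := by
  rw [pathSum, sum_eq_single (fun _ => x, Fin.elim0)]
  · simp
  · intro τ _ hτ
    rw [if_neg, zero_mul, zero_mul]
    intro h
    refine hτ (Prod.ext (funext fun i => ?_) (Subsingleton.elim _ _))
    rw [Fin.fin_one_eq_zero i, h]
  · simp

/-- Conditioning on the first step of the path. -/
lemma pathSum_succ (M : LayeredMDP S A) (pol : S → A → ℝ) (n : ℕ) (x : S)
    (f : (Fin (n + 2) → S) × (Fin (n + 1) → A) → ℝ) :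
    pathSum M pol (n + 1) x f = ∑ b, ∑ y, pol x b * M.P x b y *
      pathSum M pol n y (fun τ => f (Fin.cons x τ.1, Fin.cons b τ.2)) := by
  have expand : pathSum M pol (n + 1) x f = ∑ σ : Fin (n + 1) → S, ∑ b, ∑ α : Fin n → A,
      pol x b * M.P x b (σ 0) * ((∏ k : Fin n, pol (σ k.castSucc) (α k) *
        M.P (σ k.castSucc) (α k) (σ k.succ)) * f (Fin.cons x σ, Fin.cons b α)) := by
    rw [pathSum, Fintype.sum_prod_type, ← (Fin.consEquiv fun _ => S).sum_comp,
      Fintype.sum_prod_type, sum_eq_single x]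
    · refine sum_congr rfl fun σ _ => ?_
      rw [← (Fin.consEquiv fun _ => A).sum_comp, Fintype.sum_prod_type]
      refine sum_congr rfl fun b _ => sum_congr rfl fun α _ => ?_
      simp [Fin.consEquiv, Fin.prod_univ_succ, mul_assoc]
    · intro y _ hy
      simp [Fin.consEquiv, hy]
    · simp
  rw [expand, sum_comm]
  refine sum_congr rfl fun b _ => ?_
  simp only [pathSum, mul_sum]
  rw [sum_comm (s := univ (α := S)), Fintype.sum_prod_type]
  refine sum_congr rfl fun σ _ => sum_congr rfl fun α _ => ?_
  rw [sum_eq_single (σ 0)]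
  · simp
  · intro y _ hy
    simp [hy.symm]
  · simp

lemma LayeredMDP.ne_sL (M : LayeredMDP S A) {x : S} (hx : M.layer x < M.L) : x ≠ M.sL := by
  rintro rfl
  exact hx.ne M.layer_sL

/-- Averages over the next state only see states in the next layer. -/
lemma LayeredMDP.sum_P_mul_congr (M : LayeredMDP S A) (x : S) (b : A) {f g : S → ℝ}
    (h : ∀ y, M.layer y = M.layer x + 1 → f y = g y) :
    ∑ y, M.P x b y * f y = ∑ y, M.P x b y * g y := by
  refine sum_congr rfl fun y _ => ?_
  by_cases hy : M.P x b y = 0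
  · simp [hy]
  · rw [h y (M.P_layer x b y hy)]

lemma pathSum_one (M : LayeredMDP S A) (pol : S → A → ℝ) (hpol : IsPolicy M pol) (n : ℕ) (x : S)
    (hx : M.layer x + n = M.L) : pathSum M pol n x (fun _ => 1) = 1 := by
  induction n generalizing x with
  | zero => rw [pathSum_zero]
  | succ n ih =>
    have hlt : M.layer x < M.L := by lia
    rw [pathSum_succ]
    trans ∑ b, pol x b
    swap
    · exact hpol.2 x (M.ne_sL hlt)
    refine sum_congr rfl fun b _ => ?_
    simp only [mul_assoc, ← mul_sum]
    rw [M.sum_P_mul_congr x b (g := fun _ => 1) fun y hy => ih y (by lia)]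
    simp [M.P_sum x b hlt]

lemma pathSum_pathLoss (M : LayeredMDP S A) (pol : S → A → ℝ) (hpol : IsPolicy M pol)
    (l : S → A → ℝ) (n : ℕ) (x : S) (hx : M.layer x + n = M.L) :
    pathSum M pol n x (pathLoss l) = ∑ b, pol x b * Qfuel M pol l n x b := by
  induction n generalizing x with
  | zero => simp [pathSum_zero, pathLoss, Qfuel]
  | succ n ih =>
    have hlt : M.layer x < M.L := by lia
    rw [pathSum_succ]
    refine sum_congr rfl fun b _ => ?_
    simp only [mul_assoc, ← mul_sum, pathLoss_cons, Qfuel]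
    rw [M.sum_P_mul_congr x b (g := fun y => l x b + ∑ b', pol y b' * Qfuel M pol l n y b')]
    · simp only [mul_add, sum_add_distrib, ← sum_mul, M.P_sum x b hlt, one_mul]
    · intro y hy
      have h := pathSum_const_mul M pol n y (l x b) (fun _ => 1)
      simp only [mul_one, pathSum_one M pol hpol n y (by lia)] at h
      rw [pathSum_add M pol n y (fun _ => l x b), h, ih y (by lia)]

/-- On the event of visiting `s` at time `k`, the action at time `k` and the losses from then on
are independent of the past: `N` is the probability of the visit and `D` the past loss on it. -/
lemma exists_pathSum_visit (M : LayeredMDP S A) (pol : S → A → ℝ) (hpol : IsPolicy M pol)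
    (l : S → A → ℝ) (s : S) (n : ℕ) (k : Fin n) (hk : M.layer s + n = M.L + k) :
    ∃ N D : S → ℝ, ∀ x, ∀ g : A → ℝ,
      pathSum M pol n x (fun τ => if τ.1 k.castSucc = s then g (τ.2 k) else 0)
        = N x * ∑ b, pol s b * g b ∧
      pathSum M pol n x (fun τ => (if τ.1 k.castSucc = s then g (τ.2 k) else 0) * pathLoss l τ)
        = D x * ∑ b, pol s b * g b
          + N x * ∑ b, pol s b * (g b * Qfuel M pol l (M.L - M.layer s) s b) := by
  induction n with
  | zero => exact k.elim0
  | succ n ih =>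
    cases k using Fin.cases with
    | zero =>
      have hn : M.layer s + (n + 1) = M.L := by simpa using hk
      have hlt : M.layer s < M.L := by lia
      refine ⟨fun x => if x = s then 1 else 0, fun _ => 0, fun x g => ?_⟩
      by_cases hx : x = s
      · subst hx
        have const (y : S) (hy : M.layer y = M.layer x + 1) (r : ℝ) :
            pathSum M pol n y (fun _ => r) = r := by
          have h := pathSum_const_mul M pol n y r (fun _ => 1)
          simpa only [mul_one, pathSum_one M pol hpol n y (by lia)] using h
        have hfuel : M.L - M.layer x = n + 1 := by lia
        simp only [pathSum_succ, Fin.castSucc_zero, Fin.cons_zero, if_true, pathLoss_cons,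
          zero_mul, zero_add, one_mul, hfuel, mul_assoc, ← mul_sum]
        constructor
        · refine sum_congr rfl fun b _ => ?_
          rw [M.sum_P_mul_congr x b (g := fun _ => g b) fun y hy => const y hy _, ← sum_mul,
            M.P_sum x b hlt, one_mul]
        · refine sum_congr rfl fun b _ => ?_
          simp only [pathSum_const_mul, Qfuel]
          rw [M.sum_P_mul_congr x b
            (g := fun y => g b * (l x b + ∑ b', pol y b' * Qfuel M pol l n y b'))]
          · simp only [mul_left_comm _ (g b), ← mul_sum, mul_add, sum_add_distrib, ← sum_mul,
              M.P_sum x b hlt, one_mul]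
          · intro y hy
            rw [pathSum_add M pol n y (fun _ => l x b), const y hy,
              pathSum_pathLoss M pol hpol l n y (by lia)]
      · simp only [pathSum_succ, Fin.castSucc_zero, Fin.cons_zero, if_neg hx, zero_mul, add_zero]
        simp [pathSum]
    | succ j =>
      obtain ⟨N, D, h⟩ := ih j (by simp at hk; lia)
      refine ⟨fun x => ∑ b, ∑ y, pol x b * M.P x b y * N y,
        fun x => ∑ b, ∑ y, pol x b * M.P x b y * (l x b * N y + D y), fun x g => ⟨?_, ?_⟩⟩
      · simp only [pathSum_succ, ← Fin.succ_castSucc, Fin.cons_succ, (h _ g).1, sum_mul,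
          mul_assoc]
      · simp only [pathSum_succ, ← Fin.succ_castSucc, Fin.cons_succ, pathLoss_cons, mul_add,
          pathSum_add, mul_left_comm _ (l x _), mul_comm _ (l x _), mul_assoc,
          pathSum_const_mul, (h _ g).1, (h _ g).2]
        rw [sum_mul, sum_mul, ← sum_add_distrib]
        refine sum_congr rfl fun b _ => ?_
        rw [sum_mul, sum_mul, ← sum_add_distrib]
        exact sum_congr rfl fun y _ => by ring

/-- The expectation of `c * h (X)` for a random variable `X` with finitely many values. -/
lemma integral_mul_comp_eq_sum {Ω T : Type*} [MeasurableSpace Ω] {μ : Measure Ω} [Fintype T]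
    [DecidableEq T] {X : Ω → T} {c : Ω → ℝ} (hX : ∀ t, MeasurableSet {ω | X ω = t})
    (hc : Integrable c μ) (h : T → ℝ) :
    ∫ ω, c ω * h (X ω) ∂μ = ∑ t, (∫ ω in {ω | X ω = t}, c ω ∂μ) * h t := by
  have split : (fun ω => c ω * h (X ω))
      = fun ω => ∑ t, {ω | X ω = t}.indicator (fun ω => c ω * h t) ω := by
    funext ω
    simp [Set.indicator_apply]
  rw [split, integral_finsetSum _ fun t _ => (hc.mul_const _).indicator (hX t)]
  exact sum_congr rfl fun t _ => by rw [integral_indicator (hX t), integral_mul_const]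

/-- Lemma 2, unbiasedness of the loss estimator with known transitions.
If a trajectory is generated under `pol` and the aggregate feedback `c` satisfies
`E[c ∣ trajectory] = ∑_k ℓ(s_k, a_k)`, then for any `s ≠ s_L` and `a` with `q(s,a) > 0`,
the estimator `ℓ̂(s,a) = c·(𝕀(s,a)/q(s,a) − 𝕀(s)/q(s))` satisfies
`E[ℓ̂(s,a)] = Q^{P,π}(s,a;ℓ) − V^{P,π}(s;ℓ)`. -/
theorem stmt1 (M : LayeredMDP S A) (pol : S → A → ℝ) (hpol : IsPolicy M pol)
    (l : S → A → ℝ)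
    {Ω : Type} [MeasurableSpace Ω] (μ : Measure Ω) [IsProbabilityMeasure μ]
    (traj : Ω → Traj M) (c : Ω → ℝ)
    (hmeas : ∀ τ : Traj M, MeasurableSet {ω | traj ω = τ})
    (hdist : ∀ τ : Traj M, (μ {ω | traj ω = τ}).toReal = trajProb M pol τ)
    (hint : Integrable c μ)
    (hcond : ∀ τ : Traj M,
      ∫ ω in {ω | traj ω = τ}, c ω ∂μ = aggLoss M l τ * (μ {ω | traj ω = τ}).toReal)
    (s : S) (a : A) (hs : s ≠ M.sL) (hq : 0 < occSA M pol s a) :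
    ∫ ω, c ω * (saInd M (traj ω) s a / occSA M pol s a
        - stInd M (traj ω) s / occS M pol s) ∂μ
      = Qval M pol l s a - Vval M pol l s := by
  have hlt : M.layer s < M.L :=
    lt_of_le_of_ne (M.layer_le s) fun h => hs (M.sL_unique s h)
  obtain ⟨N, D, hND⟩ := exists_pathSum_visit M pol hpol l s M.L ⟨M.layer s, hlt⟩ (add_comm _ _)
  have hsa : ∀ τ : Traj M, saInd M τ s a = if τ.1 (Fin.castSucc ⟨M.layer s, hlt⟩) = s then
      (if τ.2 ⟨M.layer s, hlt⟩ = a then 1 else 0) else 0 := by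
    intro τ
    simp only [saInd, dif_pos hlt, ite_and]
    rfl
  have hst : ∀ τ : Traj M, stInd M τ s =
      if τ.1 (Fin.castSucc ⟨M.layer s, hlt⟩) = s then 1 else 0 := fun _ => rfl
  have hV : Vval M pol l s = ∑ b, pol s b * Qfuel M pol l (M.L - M.layer s) s b := by
    simp only [Vval, Qval, if_neg hlt.ne]
  have hQ : Qval M pol l s a = Qfuel M pol l (M.L - M.layer s) s a := if_neg hlt.ne
  obtain ⟨occSA_eq, lossSA_eq⟩ := hND M.s0 fun b => if b = a then 1 else 0
  obtain ⟨occS_eq, lossS_eq⟩ := hND M.s0 fun _ => 1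
  simp only [← hsa, mul_ite, ite_mul, mul_one, one_mul, zero_mul, mul_zero, sum_ite_eq',
    mem_univ, if_true, ← hQ] at occSA_eq lossSA_eq
  simp only [← hst, mul_one, one_mul, hpol.2 s hs, ← hV] at occS_eq lossS_eq
  change occSA M pol s a = _ at occSA_eq
  change occS M pol s = _ at occS_eq
  have split : ∫ ω, c ω * (saInd M (traj ω) s a / occSA M pol s a
        - stInd M (traj ω) s / occS M pol s) ∂μ
      = pathSum M pol M.L M.s0 (fun τ => saInd M τ s a * pathLoss l τ) / occSA M pol s a
        - pathSum M pol M.L M.s0 (fun τ => stInd M τ s * pathLoss l τ) / occS M pol s := by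
    rw [integral_mul_comp_eq_sum hmeas hint
      fun τ => saInd M τ s a / occSA M pol s a - stInd M τ s / occS M pol s]
    simp only [pathSum, sum_div, ← sum_sub_distrib]
    refine sum_congr rfl fun τ _ => ?_
    rw [hcond, hdist, aggLoss, trajProb, pathLoss]
    ring
  rw [occSA_eq] at hq
  have hN : N M.s0 ≠ 0 := left_ne_zero_of_mul hq.ne'
  have hp : pol s a ≠ 0 := right_ne_zero_of_mul hq.ne'
  rw [split, lossSA_eq, lossS_eq, occSA_eq, occS_eq]
  field_simp
  ring
end

section
/- Let φ(x) = −2√x for x ≥ 0 and let D_φ(y, x) = −2√y + 2√x + (1/√x)·(y − x) = (√x − √y)²/√x be the Bregman divergence associated with φ. Then for every x ∈ (0,1), every ℓ ∈ ℝ, and every η > 0 such that η·√x·ℓ > −1, one has sup_{y ∈ [0,1]} { ℓ·(x − y) − (1/η)·D_φ(y, x) } ≤ η·x^{3/2}·ℓ² / (1 + η·ℓ·√x). -/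
/-- stability of the one-dimensional Tsallis-entropy regularizer.
For `φ(x) = −2√x` with Bregman divergence
`D_φ(y,x) = −2√y + 2√x + (1/√x)(y − x)`, if `x ∈ (0,1)`, `η > 0` and `η√x·ℓ > −1`, then
`sup_{y ∈ [0,1]} { ℓ(x − y) − (1/η)·D_φ(y,x) } ≤ η·x^{3/2}·ℓ²/(1 + ηℓ√x)`. -/
theorem stmt7 (x ℓ η : ℝ) (hx : x ∈ Set.Ioo (0 : ℝ) 1) (hη : 0 < η)
    (hℓ : η * Real.sqrt x * ℓ > -1) :
    ∀ y ∈ Set.Icc (0 : ℝ) 1,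
      ℓ * (x - y)
          - (1 / η) * (-2 * Real.sqrt y + 2 * Real.sqrt x + (1 / Real.sqrt x) * (y - x))
        ≤ η * x ^ ((3 : ℝ) / 2) * ℓ ^ 2 / (1 + η * ℓ * Real.sqrt x) := by
  intro y hy
  have hs : 0 < √x := Real.sqrt_pos.2 hx.1
  have hxs : x = √x ^ 2 := (Real.sq_sqrt hx.1.le).symm
  have hyt : y = √y ^ 2 := (Real.sq_sqrt hy.1).symm
  have hpow : x ^ ((3 : ℝ) / 2) = √x ^ 3 := by
    rw [Real.sqrt_eq_rpow, ← Real.rpow_mul_natCast hx.1.le]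
    norm_num
  rw [hpow]
  generalize √x = s at *
  generalize √y = t at *
  subst hxs hyt
  have hc : 0 < 1 + η * ℓ * s := by linarith
  have hgap : η * s ^ 3 * ℓ ^ 2 / (1 + η * ℓ * s)
      - (ℓ * (s ^ 2 - t ^ 2) - (1 / η) * (-2 * t + 2 * s + (1 / s) * (t ^ 2 - s ^ 2)))
      = ((1 + η * ℓ * s) * t - s) ^ 2 / ((1 + η * ℓ * s) * (η * s)) := by
    generalize h : 1 + η * ℓ * s = c at *
    field_simp
    subst h
    ring
  have hnonneg : 0 ≤ ((1 + η * ℓ * s) * t - s) ^ 2 / ((1 + η * ℓ * s) * (η * s)) := by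
    positivity
  linarith
end

section
/- Let η > 0 and β > 0, and define φ : (0, ∞) → ℝ by φ(x) = −(2/η)·√x − β·ln x, with Bregman divergence D_φ(y, x) = φ(y) − φ(x) − φ'(x)·(y − x). Then for every x ∈ (0,1) and every ℓ ∈ ℝ satisfying x·ℓ ≥ −β/2, one has sup_{y ∈ (0,1]} { ℓ·(x − y) − D_φ(y, x) } ≤ 6·η·x^{3/2}·ℓ². -/
/-- Completing the square: `2 k s - (a / η) s² ≤ k² η / a`. -/
theorem two_mul_sub_sq_le {η a : ℝ} (hη : 0 < η) (ha : 0 < a) (k s : ℝ) :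
    2 * k * s - a / η * s ^ 2 ≤ k ^ 2 * η / a := by
  have h : k ^ 2 * η / a - (2 * k * s - a / η * s ^ 2) = a / η * (s - k * η / a) ^ 2 := by
    field_simp
    ring
  have : 0 ≤ a / η * (s - k * η / a) ^ 2 := by positivity
  linarith

/-- The stability estimate in the variables `a = √x` and `t = √(y / x)`. -/
theorem hybrid_stability_sqrt {η β a t ℓ : ℝ} (hη : 0 < η) (hβ : 0 < β) (ha : 0 < a) (ht : 0 < t)
    (hℓ : -β / 2 ≤ a ^ 2 * ℓ) :
    a ^ 2 * ℓ * (1 - t ^ 2) - a / η * (t - 1) ^ 2 - β * (t ^ 2 - 1 - 2 * Real.log t)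
      ≤ 6 * η * a ^ 3 * ℓ ^ 2 := by
  have hR : 0 ≤ η * a ^ 3 * ℓ ^ 2 := by positivity
  have hS : 0 ≤ a / η * (t - 1) ^ 2 := by positivity
  have hL : 0 ≤ β * (t ^ 2 - 1 - 2 * Real.log t) := by
    have h := Real.log_le_sub_one_of_pos (pow_pos ht 2)
    rw [Real.log_pow] at h
    push_cast at h
    exact mul_nonneg hβ.le (by linarith)
  have square (k : ℝ) : 2 * (k * (a ^ 2 * ℓ)) * (1 - t) - a / η * (t - 1) ^ 2
      ≤ k ^ 2 * (η * a ^ 3 * ℓ ^ 2) := by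
    have h := two_mul_sub_sq_le hη ha (k * (a ^ 2 * ℓ)) (1 - t)
    have e : (k * (a ^ 2 * ℓ)) ^ 2 * η / a = k ^ 2 * (η * a ^ 3 * ℓ ^ 2) := by
      field_simp
    rw [e] at h
    linarith [show (1 - t) ^ 2 = (t - 1) ^ 2 by ring]
  rcases le_total 0 (a ^ 2 * ℓ) with h0 | h0
  · have : a ^ 2 * ℓ * (1 - t ^ 2) ≤ 2 * (1 * (a ^ 2 * ℓ)) * (1 - t) := by
      nlinarith [mul_nonneg h0 (sq_nonneg (t - 1))]
    linarith [square 1]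
  · rcases le_total t 1 with h1 | h1
    · have : a ^ 2 * ℓ * (1 - t ^ 2) ≤ 0 := mul_nonpos_of_nonpos_of_nonneg h0 (by nlinarith)
      linarith
    · rcases le_total t 3 with h3 | h3
      · have : a ^ 2 * ℓ * (1 - t ^ 2) ≤ 2 * (2 * (a ^ 2 * ℓ)) * (1 - t) := by
          nlinarith [mul_nonneg (neg_nonneg.2 h0)
            (mul_nonneg (sub_nonneg.2 h1) (sub_nonneg.2 h3))]
        linarith [square 2]
      · have hlog := Real.log_le_sub_one_of_pos ht
        have hq : 0 ≤ t ^ 2 - 1 := by nlinarith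
        have hm : a ^ 2 * ℓ * (1 - t ^ 2) ≤ β / 2 * (t ^ 2 - 1) := by
          nlinarith [mul_nonneg (sub_nonneg.2 hℓ) hq]
        have hb : 0 ≤ β * ((t ^ 2 - 1) / 2 - 2 * Real.log t) :=
          mul_nonneg hβ.le (by nlinarith)
        linarith


/-- stability of the hybrid Tsallis-entropy/log-barrier regularizer.
For `φ(x) = −(2/η)√x − β·ln x`, with `φ'(x) = −1/(η√x) − β/x` and Bregman divergence
`D_φ(y,x) = φ(y) − φ(x) − φ'(x)(y − x)`, if `η > 0`, `β > 0`, `x ∈ (0,1)` and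
`x·ℓ ≥ −β/2`, then `sup_{y ∈ (0,1]} { ℓ(x − y) − D_φ(y,x) } ≤ 6η·x^{3/2}·ℓ²`. -/
theorem stmt8 (η β : ℝ) (hη : 0 < η) (hβ : 0 < β) (x ℓ : ℝ)
    (hx : x ∈ Set.Ioo (0 : ℝ) 1) (hℓ : x * ℓ ≥ -β / 2) :
    ∀ y ∈ Set.Ioc (0 : ℝ) 1,
      ℓ * (x - y)
          - ((-(2 / η) * Real.sqrt y - β * Real.log y)
              - (-(2 / η) * Real.sqrt x - β * Real.log x)
              - (-(1 / (η * Real.sqrt x)) - β / x) * (y - x))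
        ≤ 6 * η * x ^ ((3 : ℝ) / 2) * ℓ ^ 2 := by
  rintro y ⟨hy, -⟩
  obtain ⟨a, ha, rfl⟩ : ∃ a : ℝ, 0 < a ∧ x = a ^ 2 :=
    ⟨√x, Real.sqrt_pos.2 hx.1, (Real.sq_sqrt hx.1.le).symm⟩
  obtain ⟨t, ht, rfl⟩ : ∃ t : ℝ, 0 < t ∧ y = (a * t) ^ 2 := by
    refine ⟨√y / a, div_pos (Real.sqrt_pos.2 hy) ha, ?_⟩
    rw [mul_div_cancel₀ _ ha.ne', Real.sq_sqrt hy.le]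
  have hpow : (a ^ 2) ^ ((3 : ℝ) / 2) = a ^ 3 := by
    rw [← Real.rpow_natCast_mul ha.le, ← Real.rpow_natCast]
    norm_num
  rw [hpow, Real.sqrt_sq ha.le, Real.sqrt_sq (mul_pos ha ht).le, Real.log_pow, Real.log_pow,
    Real.log_mul ha.ne' ht.ne']
  refine le_of_eq_of_le ?_ (hybrid_stability_sqrt hη hβ ha ht hℓ)
  field_simp
  push_cast
  ring
end

section
/- Let φ(x) = −log x for x > 0 and let D_φ(y, x) = −log(y/x) + y/x − 1 be the Bregman divergence associated with φ. Then for every x ∈ (0,1), every ℓ ∈ ℝ, and every η > 0 such that η·x·ℓ > −1, one has sup_{y ∈ (0,1]} { ℓ·(x − y) − (1/η)·D_φ(y, x) } ≤ (1/η)·( −log(1 + η·x·ℓ) + η·x·ℓ ). -/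
/-- exact stability of the one-dimensional log-barrier regularizer.
For `φ(x) = −log x` with Bregman divergence `D_φ(y,x) = −log(y/x) + y/x − 1`, if
`x ∈ (0,1)`, `η > 0` and `η·x·ℓ > −1`, then
`sup_{y ∈ (0,1]} { ℓ(x − y) − (1/η)·D_φ(y,x) } ≤ (1/η)(−log(1 + ηxℓ) + ηxℓ)`. -/
theorem stmt9 (x ℓ η : ℝ) (hx : x ∈ Set.Ioo (0 : ℝ) 1) (hη : 0 < η)
    (h : η * x * ℓ > -1) :
    ∀ y ∈ Set.Ioc (0 : ℝ) 1,
      ℓ * (x - y) - (1 / η) * (-Real.log (y / x) + y / x - 1)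
        ≤ (1 / η) * (-Real.log (1 + η * x * ℓ) + η * x * ℓ) := by
  rintro y ⟨hy, -⟩
  obtain ⟨hx, -⟩ := hx
  have ha : 0 < 1 + η * x * ℓ := by linarith
  have hu : 0 < y / x := div_pos hy hx
  have key := Real.log_le_sub_one_of_pos (mul_pos hu ha)
  rw [Real.log_mul hu.ne' ha.ne'] at key
  have hlin : ℓ * (x - y) = (1 / η) * (η * x * ℓ * (1 - y / x)) := by
    field_simp
  rw [hlin, ← mul_sub]
  refine mul_le_mul_of_nonneg_left ?_ (by positivity)
  linarith
end

section
/- Let φ(x) = −log x for x > 0 and let D_φ(y, x) = −log(y/x) + y/x − 1 be the Bregman divergence associated with φ. Then for every x ∈ (0,1), every ℓ ∈ ℝ, and every η > 0 such that η·ℓ·x ≥ −1/2, one has sup_{y ∈ (0,1]} { ℓ·(x − y) − (1/η)·D_φ(y, x) } ≤ η·x²·ℓ²·( 1/2 + 𝟙[ℓ < 0]·η·x·|ℓ| ) ≤ η·x²·ℓ², where 𝟙[ℓ < 0] equals 1 if ℓ < 0 and 0 otherwise. -/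
/-- Quadratic lower bound for `log (1 + a)` on the nonnegative half-line. -/
theorem sub_sq_div_two_le_log_one_add {a : ℝ} (ha : 0 ≤ a) :
    a - a ^ 2 / 2 ≤ Real.log (1 + a) := by
  refine le_trans ?_ (Real.le_log_one_add_of_nonneg ha)
  rw [le_div_iff₀ (by positivity)]
  nlinarith [pow_nonneg ha 3]

/-- Cubic lower bound for `log (1 - b)` on `[0, 1/2]`. -/
theorem neg_cubic_le_log_one_sub {b : ℝ} (hb : 0 ≤ b) (hb' : b ≤ 1 / 2) :
    -(b + b ^ 2 / 2 + b ^ 3) ≤ Real.log (1 - b) := by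
  have taylor := Real.abs_log_sub_add_sum_range_le (x := b)
    (by rw [abs_of_nonneg hb]; linarith) 4
  rw [abs_of_nonneg hb] at taylor
  norm_num [Finset.sum_range_succ] at taylor
  have remainder : b ^ 5 / (1 - b) ≤ 2 * b ^ 5 := by
    rw [div_le_iff₀ (by linarith)]
    nlinarith [pow_nonneg hb 5]
  have four : b ^ 4 ≤ b ^ 3 / 2 := by nlinarith [pow_nonneg hb 3]
  have five : b ^ 5 ≤ b ^ 4 / 2 := by nlinarith [pow_nonneg hb 4]
  have := (abs_le.mp taylor).1
  linarith [pow_nonneg hb 3]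

/-- simplified stability of the one-dimensional log-barrier regularizer.
For `φ(x) = −log x` with Bregman divergence `D_φ(y,x) = −log(y/x) + y/x − 1`, if
`x ∈ (0,1)`, `η > 0` and `η·ℓ·x ≥ −1/2`, then
`sup_{y ∈ (0,1]} { ℓ(x − y) − (1/η)·D_φ(y,x) } ≤ η·x²·ℓ²·(1/2 + 𝟙[ℓ<0]·ηx|ℓ|) ≤ η·x²·ℓ²`. -/
theorem stmt10 (x ℓ η : ℝ) (hx : x ∈ Set.Ioo (0 : ℝ) 1) (hη : 0 < η)
    (h : η * ℓ * x ≥ -1 / 2) :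
    (∀ y ∈ Set.Ioc (0 : ℝ) 1,
      ℓ * (x - y) - (1 / η) * (-Real.log (y / x) + y / x - 1)
        ≤ η * x ^ 2 * ℓ ^ 2 * (1 / 2 + (if ℓ < 0 then (1 : ℝ) else 0) * η * x * |ℓ|)) ∧
    η * x ^ 2 * ℓ ^ 2 * (1 / 2 + (if ℓ < 0 then (1 : ℝ) else 0) * η * x * |ℓ|)
      ≤ η * x ^ 2 * ℓ ^ 2 := by
  obtain ⟨hx0, -⟩ := hx
  set a := η * ℓ * x with ha
  have key : a - Real.log (1 + a) ≤
      a ^ 2 * (1 / 2 + (if ℓ < 0 then (1 : ℝ) else 0) * η * x * |ℓ|) := by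
    split_ifs with hℓ
    · have ha0 : a ≤ 0 := by
        have := mul_pos (mul_pos hη hx0) (neg_pos.mpr hℓ)
        linarith
      have hlog := neg_cubic_le_log_one_sub (b := -a) (by linarith) (by linarith)
      have habs : 1 * η * x * |ℓ| = -a := by rw [abs_of_neg hℓ, ha]; ring
      rw [habs]
      rw [sub_neg_eq_add] at hlog
      linarith
    · have ha0 : 0 ≤ a := mul_nonneg (mul_nonneg hη.le (not_lt.mp hℓ)) hx0.le
      linarith [sub_sq_div_two_le_log_one_add ha0]
  refine ⟨fun y hy => ?_, ?_⟩
  · have hy0 := hy.1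
    have ha1 : 0 < 1 + a := by linarith
    have ht : 0 < y / x := div_pos hy0 hx0
    have hlog := Real.log_le_sub_one_of_pos (mul_pos ha1 ht)
    rw [Real.log_mul ha1.ne' ht.ne'] at hlog
    refine le_of_mul_le_mul_left ?_ hη
    calc η * (ℓ * (x - y) - (1 / η) * (-Real.log (y / x) + y / x - 1))
        = a * (1 - y / x) + Real.log (y / x) - y / x + 1 := by
          rw [ha]; field_simp; ring
      _ ≤ a - Real.log (1 + a) := by linarith
      _ ≤ _ := key
      _ = _ := by rw [ha]; ring
  · refine mul_le_of_le_one_right (by positivity) ?_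
    split_ifs with hℓ
    · rw [abs_of_neg hℓ]
      linarith
    · norm_num
end

section
/- For every real number a with a ≥ −1/2, one has −log(1 + a) + a ≤ a²/2 + 𝟙[a < 0]·|a|³, where 𝟙[a < 0] equals 1 if a < 0 and 0 otherwise. -/
theorem neg_log_one_sub_le_add_cube {x : ℝ} (hx : 0 ≤ x) (hx2 : x ≤ 1 / 2) :
    -Real.log (1 - x) ≤ x + x ^ 2 / 2 + x ^ 3 := by
  have habs : |x| = x := abs_of_nonneg hx
  have hlog := Real.abs_log_sub_add_sum_range_le (x := x) (by rw [habs]; linarith) 4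
  rw [habs] at hlog
  have htail : x ^ 5 / (1 - x) ≤ x ^ 3 / 2 := by
    rw [div_le_iff₀ (by linarith)]
    have hsq : x ^ 2 ≤ (1 - x) / 2 := by nlinarith
    calc x ^ 5 = x ^ 3 * x ^ 2 := by ring
      _ ≤ x ^ 3 * ((1 - x) / 2) := by gcongr
      _ = x ^ 3 / 2 * (1 - x) := by ring
  have hfour : x ^ 4 ≤ x ^ 3 / 2 := by
    nlinarith [mul_le_mul_of_nonneg_left hx2 (pow_nonneg hx 3)]
  have hlow := (abs_le.mp hlog).1
  norm_num [Finset.sum_range_succ] at hlow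
  linarith [pow_nonneg hx 3]

/-- For every real `a ≥ −1/2`,
`−log(1 + a) + a ≤ a²/2 + 𝟙[a < 0]·|a|³`. -/
theorem stmt11 (a : ℝ) (h : a ≥ -1 / 2) :
    -Real.log (1 + a) + a ≤ a ^ 2 / 2 + (if a < 0 then (1 : ℝ) else 0) * |a| ^ 3 := by
  split_ifs with ha
  · have key := neg_log_one_sub_le_add_cube (x := -a) (by linarith) (by linarith)
    rw [sub_neg_eq_add, neg_sq] at key
    rw [abs_of_neg ha]
    linarith
  · linarith [sub_sq_div_two_le_log_one_add (not_lt.mp ha)]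
end

section
/- Let I be a finite set and let q : I → [0, ∞) with Q := Σ_{e ∈ I} q(e) > 0. Then Σ_{e ∈ I} √(q(e)) · (1 − q(e)/Q) ≤ 2·( Σ_{e ∈ I} √(q(e)) − √Q ). -/
open Finset

/-- If `q : I → [0,∞)` on a finite set `I` with `Q = ∑ q(e) > 0`, then
`∑_e √(q(e))·(1 − q(e)/Q) ≤ 2·(∑_e √(q(e)) − √Q)`. -/
theorem stmt15 {I : Type} [Fintype I] (q : I → ℝ) (hq : ∀ e, 0 ≤ q e)
    (hQ : 0 < ∑ e, q e) :
    ∑ e, Real.sqrt (q e) * (1 - q e / ∑ e', q e')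
      ≤ 2 * ((∑ e, Real.sqrt (q e)) - Real.sqrt (∑ e, q e)) := by
  set Q := ∑ e, q e
  have hterm (e : I) : √(q e) * (1 - q e / Q) ≤ 2 * (√(q e) - q e / √Q) := by
    have hs : q e / Q = (√(q e) / √Q) ^ 2 := by
      rw [div_pow, Real.sq_sqrt (hq e), Real.sq_sqrt hQ.le]
    have ht : q e / √Q = √(q e) * (√(q e) / √Q) := by
      rw [← mul_div_assoc, Real.mul_self_sqrt (hq e)]
    rw [hs, ht]
    nlinarith [mul_nonneg (Real.sqrt_nonneg (q e)) (sq_nonneg (1 - √(q e) / √Q))]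
  calc ∑ e, √(q e) * (1 - q e / Q)
      ≤ ∑ e, 2 * (√(q e) - q e / √Q) := sum_le_sum fun e _ => hterm e
    _ = 2 * (∑ e, √(q e) - √Q) := by
      rw [← mul_sum, sum_sub_distrib, ← sum_div, Real.div_sqrt]
end

section
/- Let G = (V ∪ {s, g}, E) be a finite directed acyclic graph with source s and sink g in which every vertex lies on some s–g path. Let p* ∈ 𝒫 be an s–g path, let V* = {v ∈ V : p*(v) = 1} be the set of intermediate vertices it visits, and let π* : V ∪ {s} → E be consistent with p*, i.e. π*(v) ∈ ∂₊v for every v ∈ V ∪ {s} and p*(e) = 1 implies π*(e_-) = e. Then for every unit flow q ∈ 𝒬 and every vertex v ∈ V ∖ V*: q(v) ≤ Σ_{v' ∈ V* ∪ {s}} Σ_{e ∈ ∂₊v' ∖ {π*(v')}} q(e). -/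
open MeasureTheory Finset

variable {V E : Type}

/-- `IsTrail src tgt u v l`: the list of edges `l` forms a directed walk from `u` to `v`. -/
def IsTrail (src tgt : E → V) : V → V → List E → Prop
  | u, v, [] => u = v
  | u, v, e :: rest => src e = u ∧ IsTrail src tgt (tgt e) v rest

/-- `p : E → Bool` is the indicator vector of an `s`–`g` path. -/
def IsPathVec (src tgt : E → V) (s g : V) (p : E → Bool) : Prop :=
  ∃ l : List E, IsTrail src tgt s g l ∧ ∀ e, p e = true ↔ e ∈ l

/-- The real indicator vector of a Boolean edge set. -/
noncomputable def pathVec (p : E → Bool) : E → ℝ := fun e => if p e then 1 else 0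

/-- `𝒫`: the set of indicator vectors of `s`–`g` paths, as vectors in `ℝ^E`. -/
def pathSet (src tgt : E → V) (s g : V) : Set (E → ℝ) :=
  {x | ∃ p : E → Bool, IsPathVec src tgt s g p ∧ x = pathVec p}

/-- `𝒬 = conv(𝒫)`: the set of unit `s`–`g` flows. -/
noncomputable def flowSet (src tgt : E → V) (s g : V) : Set (E → ℝ) :=
  convexHull ℝ (pathSet src tgt s g)

variable [Fintype V] [Fintype E] [DecidableEq V] [DecidableEq E]

/-- `q(v) = ∑_{e ∈ ∂₊v} q(e)`: total flow on the edges leaving `v`. -/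
noncomputable def outSum (src : E → V) (q : E → ℝ) (v : V) : ℝ :=
  ∑ e ∈ Finset.univ.filter (fun e => src e = v), q e

/-- The weight `w(p) = ∏_{e : p(e)=1} q(e)/q(e_-)` of a path under the Markovian sampler
associated with `q` (with the Lean convention `r/0 = 0`, so in particular `0/0 = 0`). -/
noncomputable def pathWeight (src : E → V) (q : E → ℝ) (p : E → Bool) : ℝ :=
  ∏ e ∈ Finset.univ.filter (fun e => p e = true), q e / outSum src q (src e)

open Classical in
/-- The (finite) set of indicator vectors of `s`–`g` paths. -/
noncomputable def pathFinset (src tgt : E → V) (s g : V) : Finset (E → Bool) :=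
  Finset.univ.filter (IsPathVec src tgt s g)

/-- Vertex marginal of an edge vector, with the convention that the marginal at the
source `s` equals `1`. -/
noncomputable def vertMarg (src : E → V) (s : V) (x : E → ℝ) (v : V) : ℝ :=
  if v = s then 1 else ∑ e ∈ Finset.univ.filter (fun e => src e = v), x e

theorem IsTrail.rank_le {V E : Type} {src tgt : E → V} {rk : V → ℕ}
    (hrk : ∀ e, rk (src e) < rk (tgt e)) {u w : V} {l : List E} (h : IsTrail src tgt u w l) :
    rk u ≤ rk w ∧ ∀ e ∈ l, rk u ≤ rk (src e) := by
  induction l generalizing u with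
  | nil => cases h; simp
  | cons a l ih =>
    obtain ⟨rfl, h⟩ := h
    obtain ⟨h1, h2⟩ := ih h
    have ha := hrk a
    refine ⟨by omega, fun e he => ?_⟩
    rcases List.mem_cons.1 he with rfl | he
    · exact le_rfl
    · have := h2 e he
      omega

theorem IsTrail.eq_of_src_eq {V E : Type} {src tgt : E → V} {rk : V → ℕ}
    (hrk : ∀ e, rk (src e) < rk (tgt e)) {u w : V} {l : List E} (h : IsTrail src tgt u w l)
    {e e' : E} (he : e ∈ l) (he' : e' ∈ l) (hs : src e = src e') : e = e' := by
  induction l generalizing u with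
  | nil => simp at he
  | cons a l ih =>
    have hlt : ∀ b ∈ l, rk (src a) < rk (src b) := fun b hb =>
      (hrk a).trans_le ((IsTrail.rank_le hrk h.2).2 b hb)
    rcases List.mem_cons.1 he with rfl | hel
    · rcases List.mem_cons.1 he' with rfl | hel'
      · rfl
      · have := hlt _ hel'
        rw [hs] at this
        omega
    · rcases List.mem_cons.1 he' with rfl | hel'
      · have := hlt _ hel
        rw [hs] at this
        omega
      · exact ih h.2 hel hel'

theorem IsTrail.start_eq_or_exists {V E : Type} {src tgt : E → V} {u w : V} {l : List E}
    (h : IsTrail src tgt u w l) : u = w ∨ ∃ e ∈ l, src e = u := by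
  cases l with
  | nil => exact Or.inl h
  | cons a l => exact Or.inr ⟨a, List.mem_cons_self, h.1⟩

theorem IsTrail.tgt_eq_or_exists {V E : Type} {src tgt : E → V} {u w : V} {l : List E}
    (h : IsTrail src tgt u w l) {e : E} (he : e ∈ l) :
    tgt e = w ∨ ∃ e' ∈ l, src e' = tgt e := by
  induction l generalizing u with
  | nil => simp at he
  | cons a l ih =>
    have hsub : ∀ {x}, (x = w ∨ ∃ e' ∈ l, src e' = x) → x = w ∨ ∃ e' ∈ a :: l, src e' = x :=
      fun hx => hx.imp_right fun ⟨e', h1, h2⟩ => ⟨e', List.mem_cons_of_mem _ h1, h2⟩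
    rcases List.mem_cons.1 he with rfl | he
    · exact hsub h.2.start_eq_or_exists
    · exact hsub (ih h.2 he)

/-- A trail starting on a path `pstar` that ends where `pstar` does, and reaches a vertex off
`pstar`, contains an edge leaving `pstar`. -/
theorem IsTrail.exists_deviation {V E : Type} {src tgt : E → V} {g : V} {rk : V → ℕ}
    (hrk : ∀ e, rk (src e) < rk (tgt e)) {pstar : E → Bool} {πstar : V → E}
    (hnext : ∀ e, pstar e = true → tgt e = g ∨ ∃ e', src e' = tgt e ∧ pstar e' = true)
    (hcons : ∀ e, pstar e = true → πstar (src e) = e)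
    {u : V} {l : List E} (h : IsTrail src tgt u g l)
    (hu : u = g ∨ ∃ e', src e' = u ∧ pstar e' = true)
    {e₀ : E} (he₀ : e₀ ∈ l) (hoff : ¬ ∃ e, src e = src e₀ ∧ pstar e = true) :
    ∃ e ∈ l, src e ≠ g ∧ (∃ e', src e' = src e ∧ pstar e' = true) ∧ e ≠ πstar (src e) := by
  induction l generalizing u with
  | nil => simp at he₀
  | cons a l ih =>
    obtain ⟨rfl, h⟩ := h
    have hg : src a ≠ g := fun hg => by
      have h1 := (IsTrail.rank_le hrk h).1
      have h2 := hrk a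
      rw [hg] at h2
      omega
    obtain ⟨e', hs, hp⟩ := hu.resolve_left hg
    by_cases hdev : a = πstar (src a)
    · have hae : a = e' := by rw [hdev, ← hs, hcons e' hp]
      subst hae
      rcases List.mem_cons.1 he₀ with rfl | he₀
      · exact absurd ⟨_, rfl, hp⟩ hoff
      · obtain ⟨e, hel, he⟩ := ih h (hnext _ hp) he₀
        exact ⟨e, List.mem_cons_of_mem _ hel, he⟩
    · exact ⟨a, List.mem_cons_self, hg, ⟨e', hs, hp⟩, hdev⟩

/-- A linear inequality between partial edge sums holds on all flows once it holds on paths. -/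
theorem sum_le_sum_of_mem_flowSet {V E : Type} {src tgt : E → V} {s g : V} (A B : Finset E)
    (hpath : ∀ p, IsPathVec src tgt s g p →
      ∑ e ∈ A, pathVec p e ≤ ∑ e ∈ B, pathVec p e)
    {q : E → ℝ} (hq : q ∈ flowSet src tgt s g) : ∑ e ∈ A, q e ≤ ∑ e ∈ B, q e := by
  have hconv : Convex ℝ {x : E → ℝ | ∑ e ∈ A, x e ≤ ∑ e ∈ B, x e} := by
    intro x hx y hy a b ha hb _
    simp only [Set.mem_ofPred_eq, Pi.add_apply, Pi.smul_apply, smul_eq_mul,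
      Finset.sum_add_distrib, ← Finset.mul_sum] at hx hy ⊢
    gcongr
  refine convexHull_min ?_ hconv hq
  rintro _ ⟨p, hp, rfl⟩
  exact hpath p hp

theorem pathVec_nonneg {E : Type} (p : E → Bool) (e : E) : 0 ≤ pathVec p e := by
  unfold pathVec
  split_ifs <;> norm_num

/-- Lemma on off-path vertices.
In a finite DAG in which every vertex lies on some `s`–`g` path, let `p*` be an `s`–`g`
path with intermediate-vertex set `V*`, and let `π*` pick an outgoing edge of every
vertex `≠ g`, consistently with `p*`.  Then for every unit flow `q ∈ 𝒬` and every vertex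
`v ∈ V ∖ V*` (i.e. `v ≠ s`, `v ≠ g`, not visited by `p*`):
`q(v) ≤ ∑_{v' ∈ V* ∪ {s}} ∑_{e ∈ ∂₊v' ∖ {π*(v')}} q(e)`. -/
theorem stmt16 {V E : Type} [Fintype V] [Fintype E] [DecidableEq V] [DecidableEq E]
    (src tgt : E → V) (s g : V)
    (hdag : ∃ rk : V → ℕ, ∀ e, rk (src e) < rk (tgt e))
    (hcover : ∀ v : V, ∃ l : List E,
      IsTrail src tgt s g l ∧ (v = s ∨ ∃ e ∈ l, tgt e = v))
    (pstar : E → Bool) (hpstar : IsPathVec src tgt s g pstar)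
    (πstar : V → E)
    (hπedge : ∀ v : V, v ≠ g → src (πstar v) = v)
    (hcons : ∀ e : E, pstar e = true → πstar (src e) = e)
    (q : E → ℝ) (hq : q ∈ flowSet src tgt s g)
    (v : V) (hvs : v ≠ s) (hvg : v ≠ g)
    (hv : ¬ ∃ e : E, src e = v ∧ pstar e = true) :
    outSum src q v
      ≤ ∑ e ∈ Finset.univ.filter (fun e =>
          (src e = s ∨ (src e ≠ s ∧ src e ≠ g ∧ ∃ e' : E, src e' = src e ∧ pstar e' = true))
            ∧ e ≠ πstar (src e)), q e := by
  obtain ⟨rk, hrk⟩ := hdag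
  obtain ⟨ls, hls, hmem⟩ := hpstar
  have hnext : ∀ e, pstar e = true → tgt e = g ∨ ∃ e', src e' = tgt e ∧ pstar e' = true :=
    fun e he => (hls.tgt_eq_or_exists ((hmem e).1 he)).imp_right
      fun ⟨e', h1, h2⟩ => ⟨e', h2, (hmem e').2 h1⟩
  have hstart : s = g ∨ ∃ e', src e' = s ∧ pstar e' = true :=
    hls.start_eq_or_exists.imp_right fun ⟨e', h1, h2⟩ => ⟨e', h2, (hmem e').2 h1⟩
  refine sum_le_sum_of_mem_flowSet _ _ ?_ hq
  rintro p ⟨l, hl, hpl⟩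
  by_cases hvis : ∃ e₀ ∈ l, src e₀ = v
  · obtain ⟨e₀, he₀, rfl⟩ := hvis
    obtain ⟨e, hel, hg, hon, hdev⟩ := hl.exists_deviation hrk hnext hcons hstart he₀ hv
    have hleft : ∑ e ∈ Finset.univ.filter (fun e => src e = src e₀), pathVec p e
        = pathVec p e₀ := by
      refine Finset.sum_eq_single_of_mem e₀ (by simp) fun b hb hne => ?_
      have hpb : ¬ p b = true := fun h =>
        hne (hl.eq_of_src_eq hrk ((hpl b).1 h) he₀ (Finset.mem_filter.1 hb).2)
      simp [pathVec, hpb]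
    have heq : pathVec p e₀ = pathVec p e := by
      simp [pathVec, (hpl e₀).2 he₀, (hpl e).2 hel]
    rw [hleft, heq]
    refine Finset.single_le_sum (fun b _ => pathVec_nonneg p b) ?_
    rw [Finset.mem_filter]
    exact ⟨Finset.mem_univ _, (em (src e = s)).imp_right fun h => ⟨h, hg, hon⟩, hdev⟩
  · rw [Finset.sum_eq_zero]
    · exact Finset.sum_nonneg fun b _ => pathVec_nonneg p b
    · intro b hb
      have hpb : ¬ p b = true := fun h =>
        hvis ⟨b, (hpl b).1 h, (Finset.mem_filter.1 hb).2⟩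
      simp [pathVec, hpb]
end
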